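/- arXiv:2401.08533 — 2 statements merged into one kernel-verified Lean document; each statement's English description precedes it below -/
import Mathlib

section
/- Let a, τ, r, s be real numbers with 0 < τ ≤ a, r ≥ 0, s ≠ 0 and |s|·τ ≤ 1. Then a·(r² + s²) + (r·cos(sτ) − s·sin(sτ))·e^{−rτ} > a·r² + (a − τ)·s²; in particular a·(r² + s²) + (r·cos(sτ) − s·sin(sτ))·e^{−rτ} > 0. -/
/-- For real `a, τ, r, s` with `0 < τ ≤ a`, `r ≥ 0`, `s ≠ 0` and `|s|·τ ≤ 1`,
`a·(r² + s²) + (r·cos(sτ) − s·sin(sτ))·e^{−rτ} > a·r² + (a − τ)·s² ≥ 0`;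
in particular the left-hand side is positive. -/
theorem re_decomposition_pos (a τ r s : ℝ) (hτ : 0 < τ) (hτa : τ ≤ a)
    (hr : 0 ≤ r) (hs : s ≠ 0) (hsτ : |s| * τ ≤ 1) :
    a * r ^ 2 + (a - τ) * s ^ 2 <
      a * (r ^ 2 + s ^ 2) + (r * Real.cos (s * τ) - s * Real.sin (s * τ)) * Real.exp (-r * τ) ∧
    0 < a * (r ^ 2 + s ^ 2) + (r * Real.cos (s * τ) - s * Real.sin (s * τ)) * Real.exp (-r * τ) := by
  have hE := Real.exp_pos (-r * τ)
  have hE1 : Real.exp (-r * τ) ≤ 1 := Real.exp_le_one_iff.mpr (by nlinarith [mul_nonneg hr hτ.le])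
  have habs : |s * τ| ≤ 1 := by rwa [abs_mul, abs_of_pos hτ]
  have hc : 0 ≤ r * Real.cos (s * τ) * Real.exp (-r * τ) :=
    mul_nonneg (mul_nonneg hr (Real.cos_pos_of_le_one habs).le) hE.le
  have hsin : s * Real.sin (s * τ) < τ * s ^ 2 := by
    rcases lt_or_gt_of_ne hs with h | h
    · have h1 := Real.lt_sin (mul_neg_of_neg_of_pos h hτ)
      nlinarith [mul_lt_mul_of_neg_left h1 h]
    · have h1 := Real.sin_lt (mul_pos h hτ)
      nlinarith [mul_lt_mul_of_pos_left h1 h]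
  have h0 : 0 ≤ τ * s ^ 2 := by positivity
  have h2 : s * Real.sin (s * τ) * Real.exp (-r * τ) < τ * s ^ 2 :=
    (mul_lt_mul_of_pos_right hsin hE).trans_le (mul_le_of_le_one_right h0 hE1)
  have h3 : a * r ^ 2 + (a - τ) * s ^ 2 <
      a * (r ^ 2 + s ^ 2) +
        (r * Real.cos (s * τ) - s * Real.sin (s * τ)) * Real.exp (-r * τ) := by
    rw [sub_mul]; linarith
  have h4 : 0 ≤ a * r ^ 2 + (a - τ) * s ^ 2 :=
    add_nonneg (mul_nonneg (hτ.le.trans hτa) (sq_nonneg r))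
      (mul_nonneg (sub_nonneg.mpr hτa) (sq_nonneg s))
  exact ⟨h3, h4.trans_lt h3⟩
end

section
/- Fix real numbers L > 0, τ > 0, a > 0, ξ > 0, and let (u,θ) be a smooth solution of the delayed thermoelastic string with Kelvin–Voigt damping. Then for every t > 0, the energy satisfies E′(t) ≤ −(a/2)·∫₀^L u_tx(x,t)² dx + (1/a + ξ/(2τ))·∫₀^L u_x(x,t)² dx − ∫₀^L θ_x(x,t)² dx + (1/a − ξ/(2τ))·∫₀^L u_x(x,t−τ)² dx. -/
open MeasureTheory intervalIntegral

/-- Partial derivative in the space variable of `f : ℝ → ℝ → ℝ` (first argument). -/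
noncomputable def pdX (f : ℝ → ℝ → ℝ) (x t : ℝ) : ℝ := deriv (fun y => f y t) x

/-- Partial derivative in the time variable of `f : ℝ → ℝ → ℝ` (second argument). -/
noncomputable def pdT (f : ℝ → ℝ → ℝ) (x t : ℝ) : ℝ := deriv (fun s => f x s) t

/-- A smooth solution of the delayed thermoelastic string with Kelvin–Voigt damping:
`u_tt(x,t) − u_xx(x,t−τ) − a·u_txx(x,t) + θ_x(x,t) = 0`,
`θ_t(x,t) − θ_xx(x,t) + u_tx(x,t) = 0` on `(0,L)×(0,∞)`,
with Dirichlet boundary conditions. -/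
structure IsSmoothSolKVString (L τ a : ℝ) (u θ : ℝ → ℝ → ℝ) : Prop where
  smooth_u : ContDiff ℝ (⊤ : ℕ∞) (fun p : ℝ × ℝ => u p.1 p.2)
  smooth_θ : ContDiff ℝ (⊤ : ℕ∞) (fun p : ℝ × ℝ => θ p.1 p.2)
  pde_u : ∀ x ∈ Set.Ioo (0 : ℝ) L, ∀ t > (0 : ℝ),
    pdT (pdT u) x t - pdX (pdX u) x (t - τ) - a * pdX (pdX (pdT u)) x t + pdX θ x t = 0
  pde_θ : ∀ x ∈ Set.Ioo (0 : ℝ) L, ∀ t > (0 : ℝ),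
    pdT θ x t - pdX (pdX θ) x t + pdX (pdT u) x t = 0
  bc_u : ∀ t : ℝ, -τ ≤ t → u 0 t = 0 ∧ u L t = 0
  bc_θ : ∀ t : ℝ, 0 ≤ t → θ 0 t = 0 ∧ θ L t = 0

/-- The energy of the delayed thermoelastic string with Kelvin–Voigt damping. -/
noncomputable def energyKVString (L τ ξ : ℝ) (u θ : ℝ → ℝ → ℝ) (t : ℝ) : ℝ :=
  (1 / 2) * ((∫ x in (0 : ℝ)..L, ((pdT u x t) ^ 2 + (pdX u x t) ^ 2 + (θ x t) ^ 2))
    + ξ * ∫ x in (0 : ℝ)..L, ∫ ρ in (0 : ℝ)..(1 : ℝ), (pdX u x (t - τ * ρ)) ^ 2)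

/-- Joint smoothness of a function of two real variables. -/
def Smooth2 (f : ℝ → ℝ → ℝ) : Prop := ContDiff ℝ (⊤ : ℕ∞) (fun p : ℝ × ℝ => f p.1 p.2)

lemma Smooth2.hasFDerivAt {f : ℝ → ℝ → ℝ} (hf : Smooth2 f) (p : ℝ × ℝ) :
    HasFDerivAt (fun p : ℝ × ℝ => f p.1 p.2) (fderiv ℝ (fun p : ℝ × ℝ => f p.1 p.2) p) p :=
  ((ContDiff.differentiable hf (by simp)) p).hasFDerivAt

lemma Smooth2.hasX' {f : ℝ → ℝ → ℝ} (hf : Smooth2 f) (x t : ℝ) :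
    HasDerivAt (fun y => f y t) (fderiv ℝ (fun p : ℝ × ℝ => f p.1 p.2) (x, t) (1, 0)) x :=
  HasFDerivAt.comp_hasDerivAt (f := fun y => (y, t)) x (hf.hasFDerivAt (x, t)) ((hasDerivAt_id x).prodMk (hasDerivAt_const x t))

lemma Smooth2.hasT' {f : ℝ → ℝ → ℝ} (hf : Smooth2 f) (x t : ℝ) :
    HasDerivAt (fun s => f x s) (fderiv ℝ (fun p : ℝ × ℝ => f p.1 p.2) (x, t) (0, 1)) t :=
  HasFDerivAt.comp_hasDerivAt (f := fun s => (x, s)) t (hf.hasFDerivAt (x, t)) ((hasDerivAt_const t x).prodMk (hasDerivAt_id t))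

lemma Smooth2.pdX_eq {f : ℝ → ℝ → ℝ} (hf : Smooth2 f) (x t : ℝ) :
    pdX f x t = fderiv ℝ (fun p : ℝ × ℝ => f p.1 p.2) (x, t) (1, 0) := (hf.hasX' x t).deriv

lemma Smooth2.pdT_eq {f : ℝ → ℝ → ℝ} (hf : Smooth2 f) (x t : ℝ) :
    pdT f x t = fderiv ℝ (fun p : ℝ × ℝ => f p.1 p.2) (x, t) (0, 1) := (hf.hasT' x t).deriv

lemma Smooth2.hasX {f : ℝ → ℝ → ℝ} (hf : Smooth2 f) (x t : ℝ) :
    HasDerivAt (fun y => f y t) (pdX f x t) x := by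
  rw [hf.pdX_eq]; exact hf.hasX' x t

lemma Smooth2.hasT {f : ℝ → ℝ → ℝ} (hf : Smooth2 f) (x t : ℝ) :
    HasDerivAt (fun s => f x s) (pdT f x t) t := by
  rw [hf.pdT_eq]; exact hf.hasT' x t

lemma Smooth2.fderiv_smooth {f : ℝ → ℝ → ℝ} (hf : Smooth2 f) :
    ContDiff ℝ (⊤ : ℕ∞) (fderiv ℝ (fun p : ℝ × ℝ => f p.1 p.2)) :=
  ContDiff.fderiv_right hf (by simp)

lemma Smooth2.pdX {f : ℝ → ℝ → ℝ} (hf : Smooth2 f) : Smooth2 (pdX f) := by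
  have : (fun p : ℝ × ℝ => _root_.pdX f p.1 p.2) =
      fun p => fderiv ℝ (fun p : ℝ × ℝ => f p.1 p.2) p (1, 0) := by
    funext p; exact hf.pdX_eq p.1 p.2
  unfold Smooth2
  rw [this]
  exact hf.fderiv_smooth.clm_apply contDiff_const

lemma Smooth2.pdT {f : ℝ → ℝ → ℝ} (hf : Smooth2 f) : Smooth2 (pdT f) := by
  have : (fun p : ℝ × ℝ => _root_.pdT f p.1 p.2) =
      fun p => fderiv ℝ (fun p : ℝ × ℝ => f p.1 p.2) p (0, 1) := by
    funext p; exact hf.pdT_eq p.1 p.2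
  unfold Smooth2
  rw [this]
  exact hf.fderiv_smooth.clm_apply contDiff_const

lemma Smooth2.comm {f : ℝ → ℝ → ℝ} (hf : Smooth2 f) (x t : ℝ) :
    _root_.pdT (_root_.pdX f) x t = _root_.pdX (_root_.pdT f) x t := by
  have h2 : HasFDerivAt (fderiv ℝ (fun p : ℝ × ℝ => f p.1 p.2))
      (fderiv ℝ (fderiv ℝ (fun p : ℝ × ℝ => f p.1 p.2)) (x, t)) (x, t) :=
    ((hf.fderiv_smooth.differentiable (by simp)) (x, t)).hasFDerivAt
  have sym := second_derivative_symmetric (fun y => hf.hasFDerivAt y) h2 (0, 1) (1, 0)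
  have hA : HasDerivAt (fun s => _root_.pdX f x s)
      (fderiv ℝ (fderiv ℝ (fun p : ℝ × ℝ => f p.1 p.2)) (x, t) (0, 1) (1, 0)) t := by
    have h3 := h2.comp_hasDerivAt t ((hasDerivAt_const t x).prodMk (hasDerivAt_id t))
    have h4 := h3.clm_apply (hasDerivAt_const t ((1 : ℝ), (0 : ℝ)))
    simp only [map_zero, add_zero] at h4
    refine h4.congr_of_eventuallyEq (Filter.Eventually.of_forall fun s => ?_)
    exact hf.pdX_eq x s
  have hB : HasDerivAt (fun y => _root_.pdT f y t)
      (fderiv ℝ (fderiv ℝ (fun p : ℝ × ℝ => f p.1 p.2)) (x, t) (1, 0) (0, 1)) x := by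
    have h3 := h2.comp_hasDerivAt x ((hasDerivAt_id x).prodMk (hasDerivAt_const x t))
    have h4 := h3.clm_apply (hasDerivAt_const x ((0 : ℝ), (1 : ℝ)))
    simp only [map_zero, add_zero] at h4
    refine h4.congr_of_eventuallyEq (Filter.Eventually.of_forall fun s => ?_)
    exact hf.pdT_eq s t
  have e1 : _root_.pdT (_root_.pdX f) x t = _ := hA.deriv
  have e2 : _root_.pdX (_root_.pdT f) x t = _ := hB.deriv
  rw [e1, e2, sym]

lemma Smooth2.cont {f : ℝ → ℝ → ℝ} (hf : Smooth2 f) :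
    Continuous (fun p : ℝ × ℝ => f p.1 p.2) := ContDiff.continuous hf

lemma Smooth2.contX {f : ℝ → ℝ → ℝ} (hf : Smooth2 f) (t : ℝ) :
    Continuous (fun x => f x t) :=
  hf.cont.comp (continuous_id.prodMk continuous_const)

/-- Differentiation under the integral sign. -/
lemma hasDerivAt_param (f f' : ℝ → ℝ → ℝ) (A B t : ℝ)
    (hf : ∀ s, Continuous (fun x => f x s))
    (hd : ∀ x s, HasDerivAt (fun r => f x r) (f' x s) s)
    (hf' : Continuous (fun p : ℝ × ℝ => f' p.1 p.2)) :
    HasDerivAt (fun s => ∫ x in A..B, f x s) (∫ x in A..B, f' x t) t := by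
  obtain ⟨C, hC⟩ := ((isCompact_uIcc (a := A) (b := B)).prod
    (isCompact_Icc (a := t - 1) (b := t + 1))).exists_bound_of_continuousOn hf'.continuousOn
  refine (intervalIntegral.hasDerivAt_integral_of_dominated_loc_of_deriv_le
    (F := fun s x => f x s) (F' := fun s x => f' x s) (bound := fun _ => C)
    (s := Set.Icc (t - 1) (t + 1)) (Icc_mem_nhds (by linarith) (by linarith)) ?_ ?_ ?_ ?_ ?_ ?_).2
  · exact Filter.Eventually.of_forall fun s => (hf s).aestronglyMeasurable
  · exact (hf t).intervalIntegrable _ _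
  · exact (hf'.comp (continuous_id.prodMk continuous_const)).aestronglyMeasurable
  · exact Filter.Eventually.of_forall fun x hx s hs =>
      hC (x, s) ⟨Set.uIoc_subset_uIcc hx, hs⟩
  · exact intervalIntegrable_const
  · exact Filter.Eventually.of_forall fun x hx s hs => hd x s

/-- Energy dissipation estimate for the delayed thermoelastic string with
Kelvin–Voigt damping. -/
theorem energy_derivative_estimate_KVstring
    (L τ a ξ : ℝ) (hL : 0 < L) (hτ : 0 < τ) (ha : 0 < a) (hξ : 0 < ξ)
    (u θ : ℝ → ℝ → ℝ) (hsol : IsSmoothSolKVString L τ a u θ) :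
    ∀ t > (0 : ℝ),
      deriv (energyKVString L τ ξ u θ) t ≤
        -(a / 2) * (∫ x in (0 : ℝ)..L, (pdX (pdT u) x t) ^ 2)
        + (1 / a + ξ / (2 * τ)) * (∫ x in (0 : ℝ)..L, (pdX u x t) ^ 2)
        - (∫ x in (0 : ℝ)..L, (pdX θ x t) ^ 2)
        + (1 / a - ξ / (2 * τ)) * (∫ x in (0 : ℝ)..L, (pdX u x (t - τ)) ^ 2) := by
  intro t ht
  have hu : Smooth2 u := hsol.smooth_u
  have hθ : Smooth2 θ := hsol.smooth_θ
  have hut := hu.pdT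
  have hux := hu.pdX
  have cu := hu.cont
  have cθ := hθ.cont
  have cut := hut.cont
  have cux := hux.cont
  have cutt := hut.pdT.cont
  have cutx := hut.pdX.cont
  have cθt := hθ.pdT.cont
  have c1 := fun s => hu.contX s
  have c2 := fun s => hθ.contX s
  have c3 := fun s => hut.contX s
  have c4 := fun s => hux.contX s
  have c5 := fun s => hut.pdT.contX s
  have c6 := fun s => hut.pdX.contX s
  have c7 := fun s => hθ.pdT.contX s
  have c8 := fun s => hθ.pdX.contX s
  have c9 := fun s => hut.pdX.pdX.contX s
  have c10 := fun s => hux.pdX.contX s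
  have c11 := fun s => hθ.pdX.pdX.contX s
  have D1 := hasDerivAt_param
    (fun x s => (pdT u x s) ^ 2 + (pdX u x s) ^ 2 + (θ x s) ^ 2)
    (fun x s => 2 * pdT u x s * pdT (pdT u) x s + 2 * pdX u x s * pdX (pdT u) x s
      + 2 * θ x s * pdT θ x s) 0 L t (fun s => by fun_prop)
    (fun x s => by
      have h1 := (hut.hasT x s).pow 2
      have h2 := (hux.hasT x s).pow 2
      have h3 := (hθ.hasT x s).pow 2
      rw [hu.comm] at h2
      refine HasDerivAt.congr_deriv (f := fun r => (pdT u x r) ^ 2 + (pdX u x r) ^ 2 + (θ x r) ^ 2)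
        ((h1.add h2).add h3) ?_
      norm_num)
    (by fun_prop)
  have D2 := hasDerivAt_param
    (fun x s => ∫ ρ in (0 : ℝ)..(1 : ℝ), (pdX u x (s - τ * ρ)) ^ 2)
    (fun x s => τ⁻¹ * ((pdX u x s) ^ 2 - (pdX u x (s - τ)) ^ 2)) 0 L t
    (fun s => by
      apply intervalIntegral.continuous_parametric_intervalIntegral_of_continuous'
      have : Continuous (fun p : ℝ × ℝ => (p.1, s - τ * p.2)) := by fun_prop
      exact (cux.comp this).pow 2)
    (fun x s => by
      have cx : Continuous (fun r => (pdX u x r) ^ 2) :=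
        (cux.comp (continuous_const.prodMk continuous_id)).pow 2
      have e : (fun r => ∫ ρ in (0 : ℝ)..(1 : ℝ), (pdX u x (r - τ * ρ)) ^ 2) =
          fun r => τ⁻¹ * ((∫ y in (0 : ℝ)..r, (pdX u x y) ^ 2)
            - ∫ y in (0 : ℝ)..(r - τ), (pdX u x y) ^ 2) := by
        funext r
        rw [intervalIntegral.integral_comp_sub_mul (fun y => (pdX u x y) ^ 2) hτ.ne' r,
          intervalIntegral.integral_interval_sub_left (cx.intervalIntegrable _ _)
            (cx.intervalIntegrable _ _)]
        simp
      rw [e]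
      have P : ∀ r, HasDerivAt (fun r => ∫ y in (0 : ℝ)..r, (pdX u x y) ^ 2)
          ((pdX u x r) ^ 2) r := fun r =>
        intervalIntegral.integral_hasDerivAt_right (cx.intervalIntegrable _ _)
          (cx.stronglyMeasurableAtFilter _ _) cx.continuousAt
      exact ((P s).sub ((P (s - τ)).comp_sub_const s τ)).const_mul τ⁻¹)
    (by
      have h2 : Continuous (fun p : ℝ × ℝ => pdX u p.1 (p.2 - τ)) := by
        have : Continuous (fun p : ℝ × ℝ => (p.1, p.2 - τ)) := by fun_prop
        exact cux.comp this
      fun_prop)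
  have D := ((D1.add (D2.const_mul ξ)).const_mul (1 / 2)).deriv
  have Deriv_eq : deriv (energyKVString L τ ξ u θ) t = _ := D
  rw [Deriv_eq]
  have b0 : pdT u 0 t = 0 := by
    have : (fun s => u 0 s) =ᶠ[nhds t] fun _ => 0 := by
      filter_upwards [lt_mem_nhds ht] with s hs
      exact (hsol.bc_u s (by linarith)).1
    unfold pdT
    rw [this.deriv_eq]; simp
  have bL : pdT u L t = 0 := by
    have : (fun s => u L s) =ᶠ[nhds t] fun _ => 0 := by
      filter_upwards [lt_mem_nhds ht] with s hs
      exact (hsol.bc_u s (by linarith)).2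
    unfold pdT
    rw [this.deriv_eq]; simp
  obtain ⟨t0, tL⟩ := hsol.bc_θ t ht.le
  have flux : ∫ x in (0 : ℝ)..L,
      (pdX (pdT u) x t * (pdX u x (t - τ) + a * pdX (pdT u) x t - θ x t)
        + pdT u x t * (pdX (pdX u) x (t - τ) + a * pdX (pdX (pdT u)) x t - pdX θ x t)
        + (pdX θ x t * pdX θ x t + θ x t * pdX (pdX θ) x t)) = 0 := by
    rw [intervalIntegral.integral_eq_sub_of_hasDerivAt
      (f := fun x => pdT u x t * (pdX u x (t - τ) + a * pdX (pdT u) x t - θ x t)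
        + θ x t * pdX θ x t)]
    · simp [b0, bL, t0, tL]
    · intro x _
      exact ((hut.hasX x t).mul (((hux.hasX x (t - τ)).add
        ((hut.pdX.hasX x t).const_mul a)).sub (hθ.hasX x t))).add
        ((hθ.hasX x t).mul (hθ.pdX.hasX x t))
    · apply Continuous.intervalIntegrable
      fun_prop
  rw [← intervalIntegral.integral_const_mul ξ, ← intervalIntegral.integral_add
    (Continuous.intervalIntegrable (by fun_prop) _ _)
    (Continuous.intervalIntegrable (by fun_prop) _ _), ← intervalIntegral.integral_const_mul]
  have R : -(a / 2) * (∫ x in (0 : ℝ)..L, (pdX (pdT u) x t) ^ 2)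
        + (1 / a + ξ / (2 * τ)) * (∫ x in (0 : ℝ)..L, (pdX u x t) ^ 2)
        - (∫ x in (0 : ℝ)..L, (pdX θ x t) ^ 2)
        + (1 / a - ξ / (2 * τ)) * (∫ x in (0 : ℝ)..L, (pdX u x (t - τ)) ^ 2)
      = ∫ x in (0 : ℝ)..L, (-(a / 2) * (pdX (pdT u) x t) ^ 2
        + (1 / a + ξ / (2 * τ)) * (pdX u x t) ^ 2 - (pdX θ x t) ^ 2
        + (1 / a - ξ / (2 * τ)) * (pdX u x (t - τ)) ^ 2) := by
    rw [intervalIntegral.integral_add, intervalIntegral.integral_sub,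
      intervalIntegral.integral_add]
    · simp only [intervalIntegral.integral_const_mul]
    all_goals exact Continuous.intervalIntegrable (by fun_prop) _ _
  have aux : ∀ A B C : ℝ, B = 0 → A ≤ C + B → A ≤ C := fun A B C h1 h2 => by linarith
  rw [R]
  refine aux _ _ _ flux ?_
  rw [← intervalIntegral.integral_add
    (Continuous.intervalIntegrable (by fun_prop) _ _)
    (Continuous.intervalIntegrable (by fun_prop) _ _)]
  refine intervalIntegral.integral_mono_on_of_le_Ioo hL.le
    (Continuous.intervalIntegrable (by fun_prop) _ _)
    (Continuous.intervalIntegrable (by fun_prop) _ _) ?_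
  intro x hx
  have p1 := hsol.pde_u x hx t ht
  have p2 := hsol.pde_θ x hx t ht
  have q1 : pdT (pdT u) x t = pdX (pdX u) x (t - τ) + a * pdX (pdX (pdT u)) x t - pdX θ x t := by
    linarith
  have q2 : pdT θ x t = pdX (pdX θ) x t - pdX (pdT u) x t := by linarith
  rw [q1, q2]
  generalize pdX (pdT u) x t = v
  generalize pdX u x t = p
  generalize pdX u x (t - τ) = q
  have key : v * (p - q) ≤ a / 2 * v ^ 2 + 1 / a * p ^ 2 + 1 / a * q ^ 2 := by
    have : a / 2 * v ^ 2 + 1 / a * p ^ 2 + 1 / a * q ^ 2 - v * (p - q)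
      = ((a * v - (p - q)) ^ 2 + (p + q) ^ 2) / (2 * a) := by
      field_simp
      ring
    have : 0 ≤ ((a * v - (p - q)) ^ 2 + (p + q) ^ 2) / (2 * a) := by positivity
    linarith
  have hx2 : ξ / (2 * τ) = ξ * τ⁻¹ / 2 := by
    field_simp
  rw [hx2]
  linarith
end
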